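/- arXiv:math/0210428 — 2 statements merged into one kernel-verified Lean document; each statement's English description precedes it below -/
import Mathlib

section
/- If I ⊆ J are abelian ideals of Δ⁺, then there exists a chain of abelian ideals I = I₀ ⊆ I₁ ⊆ ⋯ ⊆ I_m = J with #(I_{k+1}) = #(I_k) + 1 for all 0 ≤ k < m. In particular, the poset of all abelian ideals of Δ⁺ ordered by inclusion is a ranked poset with cardinality as rank function. -/
open scoped BigOperators

/-- Data of a reduced irreducible crystallographic root system `Δ`, spanning a
`ℚ`-vector space `V` equipped with a Weyl-group-invariant inner product `B`,
together with a chosen system of positive roots `Pos` and the highest root `θ`. -/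
structure RootSystemCtx (V : Type*) [AddCommGroup V] [Module ℚ V] where
  /-- the invariant inner product `( , )` -/
  B : V →ₗ[ℚ] V →ₗ[ℚ] ℚ
  B_symm : ∀ x y : V, B x y = B y x
  B_posdef : ∀ x : V, x ≠ 0 → 0 < B x x
  /-- the set of roots -/
  Δ : Set V
  Δ_finite : Δ.Finite
  Δ_spans : Submodule.span ℚ Δ = ⊤
  zero_notMem_Δ : (0 : V) ∉ Δ
  neg_mem_Δ : ∀ α ∈ Δ, -α ∈ Δ
  reduced : ∀ α ∈ Δ, ∀ c : ℚ, c • α ∈ Δ → c = 1 ∨ c = -1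
  crystallographic : ∀ α ∈ Δ, ∀ β ∈ Δ, ∃ n : ℤ, 2 * B α β / B β β = (n : ℚ)
  reflect_mem : ∀ α ∈ Δ, ∀ β ∈ Δ, β - (2 * B β α / B α α) • α ∈ Δ
  irreducible : ∀ S : Set V, S ⊆ Δ → (∀ α ∈ S, ∀ β ∈ Δ \ S, B α β = 0) → S = ∅ ∨ S = Δ
  /-- the positive roots `Δ⁺` -/
  Pos : Set V
  pos_subset : Pos ⊆ Δ
  mem_pos_or_neg_pos : ∀ α ∈ Δ, α ∈ Pos ∨ -α ∈ Pos
  pos_not_neg : ∀ α ∈ Pos, -α ∉ Pos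
  add_pos_mem : ∀ α ∈ Pos, ∀ β ∈ Pos, α + β ∈ Δ → α + β ∈ Pos
  /-- the highest root `θ` -/
  θ : V
  θ_pos : θ ∈ Pos
  θ_highest : ∀ ν ∈ Δ, θ - ν ∈ AddSubmonoid.closure Pos

namespace RootSystemCtx

variable {V : Type*} [AddCommGroup V] [Module ℚ V] (ctx : RootSystemCtx V)

/-- the simple roots `Π`: indecomposable positive roots -/
def simple : Set V :=
  {α | α ∈ ctx.Pos ∧ ¬∃ β ∈ ctx.Pos, ∃ γ ∈ ctx.Pos, α = β + γ}

/-- `ρ`, the half-sum of all positive roots -/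
noncomputable def ρ : V :=
  (1 / 2 : ℚ) • ∑ α ∈ (ctx.Δ_finite.subset ctx.pos_subset).toFinset, α

/-- the coroot `μ∨ = 2μ/(μ,μ)` -/
noncomputable def coroot (μ : V) : V := (2 / ctx.B μ μ) • μ

/-- `Δ⁺_l`, the long positive roots (roots of the same length as `θ`) -/
def PosLong : Set V := {μ | μ ∈ ctx.Pos ∧ ctx.B μ μ = ctx.B ctx.θ ctx.θ}

/-- `Π_l`, the long simple roots -/
def SimpleLong : Set V := {μ | μ ∈ ctx.simple ∧ ctx.B μ μ = ctx.B ctx.θ ctx.θ}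

/-- the dominance order `μ ≼ ν` on the root lattice: `ν - μ` is a nonnegative
integer combination of positive roots -/
def le (μ ν : V) : Prop := ν - μ ∈ AddSubmonoid.closure ctx.Pos

/-- a (combinatorial) abelian ideal of `Δ⁺` -/
def IsAbelianIdeal (I : Set V) : Prop :=
  I ⊆ ctx.Pos ∧ (∀ μ ∈ I, ∀ ν ∈ I, μ + ν ∉ ctx.Δ) ∧
    ∀ γ ∈ I, ∀ ν ∈ ctx.Pos, γ + ν ∈ ctx.Δ → γ + ν ∈ I

/-- `γ` is a generator of the ideal `I` -/
def IsGenerator (I : Set V) (γ : V) : Prop := γ ∈ I ∧ ∀ α ∈ ctx.Pos, γ - α ∉ I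

/-! ### The affine picture: `V̂ = V ⊕ ℚδ ⊕ ℚλ`, modelled as `V × ℚ × ℚ`,
with `δ = (0,1,0)` and `λ = (0,0,1)`. -/

/-- the embedding of `V` into `V̂` -/
def emb (_ctx : RootSystemCtx V) (v : V) : V × ℚ × ℚ := (v, 0, 0)

/-- the imaginary root `δ` -/
def δhat (_ctx : RootSystemCtx V) : V × ℚ × ℚ := (0, 1, 0)

/-- the affine simple root `α₀ = δ - θ` -/
def alpha0 : V × ℚ × ℚ := (-ctx.θ, 1, 0)

/-- the extension of the inner product to `V̂`, with
`(δ,V)=(λ,V)=(δ,δ)=(λ,λ)=0` and `(δ,λ)=1` -/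
noncomputable def Bhat : (V × ℚ × ℚ) →ₗ[ℚ] (V × ℚ × ℚ) →ₗ[ℚ] ℚ :=
  LinearMap.mk₂ ℚ (fun x y => ctx.B x.1 y.1 + x.2.1 * y.2.2 + x.2.2 * y.2.1)
    (fun x x' y => by
      simp only [Prod.fst_add, Prod.snd_add, map_add, LinearMap.add_apply]; ring)
    (fun c x y => by
      simp only [Prod.smul_fst, Prod.smul_snd, map_smul, LinearMap.smul_apply,
        smul_eq_mul]; ring)
    (fun x y y' => by
      simp only [Prod.fst_add, Prod.snd_add, map_add]; ring)
    (fun c x y => by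
      simp only [Prod.smul_fst, Prod.smul_snd, map_smul, smul_eq_mul]; ring)

/-- the set `Δ̂` of affine real roots -/
def Δhat : Set (V × ℚ × ℚ) := {x | ∃ α ∈ ctx.Δ, ∃ k : ℤ, x = (α, (k : ℚ), 0)}

/-- the set `Δ̂⁺` of positive affine roots -/
def PosHat : Set (V × ℚ × ℚ) :=
  {x | ∃ α ∈ ctx.Pos, x = (α, 0, 0)} ∪
    {x | ∃ α ∈ ctx.Δ, ∃ k : ℤ, 1 ≤ k ∧ x = (α, (k : ℚ), 0)}

/-- the set `Π̂ = Π ∪ {α₀}` of affine simple roots -/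
def SimpleHat : Set (V × ℚ × ℚ) :=
  {x | ∃ α ∈ ctx.simple, x = (α, (0 : ℚ), (0 : ℚ))} ∪ {ctx.alpha0}

/-- the reflection `s_β : x ↦ x − (2(x,β)/(β,β))·β` in `V̂` -/
noncomputable def refl (β : V × ℚ × ℚ) : (V × ℚ × ℚ) ≃ₗ[ℚ] (V × ℚ × ℚ) :=
  if h : ctx.Bhat β β = 0 then LinearEquiv.refl ℚ _
  else
    Module.reflection (x := β) (f := (2 / ctx.Bhat β β) • ctx.Bhat β)
      (by simp only [LinearMap.smul_apply, smul_eq_mul]; field_simp)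

/-- the affine Weyl group `Ŵ`, generated by the reflections `s_β`, `β ∈ Δ̂` -/
def What : Subgroup ((V × ℚ × ℚ) ≃ₗ[ℚ] (V × ℚ × ℚ)) :=
  Subgroup.closure {g | ∃ β ∈ ctx.Δhat, g = ctx.refl β}

/-- the finite Weyl group `W`, generated by the reflections `s_α`, `α ∈ Δ`
(identified with a subgroup of `Ŵ`) -/
def Wfin : Subgroup ((V × ℚ × ℚ) ≃ₗ[ℚ] (V × ℚ × ℚ)) :=
  Subgroup.closure {g | ∃ α ∈ ctx.Δ, g = ctx.refl (α, (0 : ℚ), (0 : ℚ))}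

/-- `N̂(w) = {β ∈ Δ̂⁺ : w(β) ∈ −Δ̂⁺}` -/
def Nhat (w : (V × ℚ × ℚ) ≃ₗ[ℚ] (V × ℚ × ℚ)) : Set (V × ℚ × ℚ) :=
  {β | β ∈ ctx.PosHat ∧ -(w β) ∈ ctx.PosHat}

/-- a minuscule element of `Ŵ`: every element of `N̂(w)` has the form `δ - γ`
with `γ ∈ Δ⁺` -/
def IsMinuscule (w : (V × ℚ × ℚ) ≃ₗ[ℚ] (V × ℚ × ℚ)) : Prop :=
  w ∈ ctx.What ∧ ∀ β ∈ ctx.Nhat w, ∃ γ ∈ ctx.Pos, β = ctx.δhat - ctx.emb γ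

/-- the abelian ideal `I_w` corresponding to a minuscule element `w` -/
def idealOf (w : (V × ℚ × ℚ) ≃ₗ[ℚ] (V × ℚ × ℚ)) : Set V :=
  {γ | γ ∈ ctx.Pos ∧ ctx.δhat - ctx.emb γ ∈ ctx.Nhat w}

/-- the ideal `I` has rootlet `τ(I) = μ`, i.e. `I = I_w` for some minuscule `w`
with `w(α₀) + δ = μ` -/
def HasRootlet (I : Set V) (μ : V) : Prop :=
  ∃ w, ctx.IsMinuscule w ∧ ctx.idealOf w = I ∧ w ctx.alpha0 + ctx.δhat = ctx.emb μ

/-- `Ab_μ`, the set of nonempty abelian ideals with rootlet `μ` -/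
def AbFiber (μ : V) : Set (Set V) := {I | I.Nonempty ∧ ctx.HasRootlet I μ}

/-- `N(u) = {γ ∈ Δ⁺ : u(γ) ∈ −Δ⁺}` for `u` in the finite Weyl group -/
def Nfin (w : (V × ℚ × ℚ) ≃ₗ[ℚ] (V × ℚ × ℚ)) : Set V :=
  {γ | γ ∈ ctx.Pos ∧ -(w (ctx.emb γ)) ∈ ctx.PosHat}

/-- the length `l(u) = #N(u)` of an element of the finite Weyl group -/
noncomputable def lenFin (w : (V × ℚ × ℚ) ≃ₗ[ℚ] (V × ℚ × ℚ)) : ℕ :=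
  (ctx.Nfin w).ncard

end RootSystemCtx

namespace RootSystemCtx

variable {V : Type*} [AddCommGroup V] [Module ℚ V] (ctx : RootSystemCtx V)

theorem ne_zero_of_mem_pos {α : V} (hα : α ∈ ctx.Pos) : α ≠ 0 :=
  fun h => ctx.zero_notMem_Δ (h ▸ ctx.pos_subset hα)

theorem B_self_pos_of_mem_pos {α : V} (hα : α ∈ ctx.Pos) : 0 < ctx.B α α :=
  ctx.B_posdef α (ctx.ne_zero_of_mem_pos hα)

/-- The equality case of the Cauchy-Schwarz inequality. -/
theorem eq_smul_of_B_self_mul_le {x y : V} (hy : 0 < ctx.B y y)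
    (h : ctx.B x x * ctx.B y y ≤ ctx.B x y ^ 2) : x = (ctx.B x y / ctx.B y y) • y := by
  have hB : ctx.B (x - (ctx.B x y / ctx.B y y) • y) (x - (ctx.B x y / ctx.B y y) • y) =
      (ctx.B x x * ctx.B y y - ctx.B x y ^ 2) / ctx.B y y := by
    simp only [map_sub, map_smul, LinearMap.sub_apply, LinearMap.smul_apply, smul_eq_mul,
      ctx.B_symm y x]
    field_simp
    ring
  by_contra hne
  have hpos := ctx.B_posdef _ (sub_ne_zero.mpr hne)
  rw [hB] at hpos
  exact absurd hpos (not_lt.mpr (div_nonpos_of_nonpos_of_nonneg (by linarith) hy.le))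

/-- Two positive roots forming an obtuse angle have a positive root as their sum. -/
theorem add_mem_pos_of_B_neg {α β : V} (hα : α ∈ ctx.Pos) (hβ : β ∈ ctx.Pos)
    (h : ctx.B α β < 0) : α + β ∈ ctx.Pos := by
  have hαΔ := ctx.pos_subset hα
  have hβΔ := ctx.pos_subset hβ
  have hαα := ctx.B_self_pos_of_mem_pos hα
  have hββ := ctx.B_self_pos_of_mem_pos hβ
  refine ctx.add_pos_mem α hα β hβ ?_
  obtain ⟨p, hp⟩ := ctx.crystallographic α hαΔ β hβΔ
  obtain ⟨q, hq⟩ := ctx.crystallographic β hβΔ α hαΔ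
  have hp0 : p < 0 := by
    have : (p : ℚ) < 0 := hp ▸ div_neg_of_neg_of_pos (by linarith) hββ
    exact_mod_cast this
  have hq0 : q < 0 := by
    have : (q : ℚ) < 0 := by
      rw [← hq, ctx.B_symm β α]
      exact div_neg_of_neg_of_pos (by linarith) hαα
    exact_mod_cast this
  by_cases hp1 : p = -1
  · have hr := ctx.reflect_mem β hβΔ α hαΔ
    rw [hp, hp1] at hr
    simpa using hr
  by_cases hq1 : q = -1
  · have hr := ctx.reflect_mem α hαΔ β hβΔ
    rw [hq, hq1] at hr
    simpa [add_comm] using hr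
  exfalso
  have hpq : (4 : ℚ) ≤ p * q := by
    have : 4 ≤ p * q := by
      have hp2 : p ≤ -2 := by omega
      have hq2 : q ≤ -2 := by omega
      nlinarith
    exact_mod_cast this
  rw [← hp, ← hq, ctx.B_symm β α, div_mul_div_comm, le_div_iff₀ (mul_pos hββ hαα)] at hpq
  have hsmul := ctx.eq_smul_of_B_self_mul_le (x := α) hββ (by linarith)
  have hc : ctx.B α β / ctx.B β β < 0 := div_neg_of_neg_of_pos h hββ
  rcases ctx.reduced β hβΔ _ (hsmul ▸ hαΔ) with h1 | h1
  · linarith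
  · rw [h1, neg_one_smul] at hsmul
    exact ctx.pos_not_neg β hβ (hsmul ▸ hα)

theorem eq_zero_of_sum_eq_zero (s : Multiset V) (hs : ∀ α ∈ s, α ∈ ctx.Pos)
    (h0 : s.sum = 0) : s = 0 := by
  induction hn : s.card generalizing s with
  | zero => exact Multiset.card_eq_zero.mp hn
  | succ n ih =>
    exfalso
    obtain ⟨α, hαs⟩ := Multiset.card_pos_iff_exists_mem.mp (hn.symm ▸ n.succ_pos : 0 < s.card)
    obtain ⟨t, rfl⟩ := Multiset.exists_cons_of_mem hαs
    have hα : α ∈ ctx.Pos := hs α (Multiset.mem_cons_self α t)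
    have hneg : ∃ β ∈ t, ctx.B α β < 0 := by
      by_contra! hge
      have h1 : 0 ≤ (t.map (ctx.B α)).sum := by
        apply Multiset.sum_nonneg
        simpa using hge
      rw [← map_multiset_sum] at h1
      have h2 := congrArg (ctx.B α) h0
      rw [Multiset.sum_cons, map_add, map_zero] at h2
      linarith [ctx.B_self_pos_of_mem_pos hα]
    obtain ⟨β, hβt, hβ⟩ := hneg
    obtain ⟨u, rfl⟩ := Multiset.exists_cons_of_mem hβt
    have hu := ih ((α + β) ::ₘ u)
      (by
        intro γ hγ
        rcases Multiset.mem_cons.mp hγ with rfl | hγ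
        · exact ctx.add_mem_pos_of_B_neg hα (hs β (by simp)) hβ
        · exact hs γ (by simp [hγ]))
      (by simpa [add_assoc] using h0) (by simpa using hn)
    simp at hu

/-- The cone of positive roots contains no negative root. -/
theorem neg_notMem_closure_pos {α : V} (hα : α ∈ ctx.Pos) :
    -α ∉ AddSubmonoid.closure ctx.Pos := by
  intro h
  obtain ⟨s, hs, hsum⟩ := AddSubmonoid.exists_multiset_of_mem_closure h
  have := ctx.eq_zero_of_sum_eq_zero (α ::ₘ s)
    (fun γ hγ => (Multiset.mem_cons.mp hγ).elim (fun e => e ▸ hα) (hs γ)) (by simp [hsum])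
  simp at this

/-- A nonempty finite set of vectors has an element that is maximal with respect to adding
positive roots. -/
theorem exists_forall_add_notMem {S : Set V} (hS : S.Finite) (hne : S.Nonempty) :
    ∃ γ ∈ S, ∀ ν ∈ ctx.Pos, γ + ν ∉ S := by
  obtain ⟨γ, hγ, hmin⟩ := Set.exists_min_image S (fun x => {y ∈ S | ctx.le x y}.ncard) hS hne
  refine ⟨γ, hγ, fun ν hν hmem => ?_⟩
  refine absurd (hmin _ hmem) (not_le.mpr ?_)
  refine Set.ncard_lt_ncard ⟨fun y hy => ⟨hy.1, ?_⟩, fun hsub => ?_⟩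
    (hS.subset (Set.sep_subset _ _))
  · have := add_mem hy.2 (AddSubmonoid.subset_closure hν)
    rwa [show y - (γ + ν) + ν = y - γ by abel] at this
  · have hle := (hsub ⟨hγ, by simp [le]⟩ : γ ∈ {y ∈ S | ctx.le (γ + ν) y}).2
    rw [le, show γ - (γ + ν) = -ν by abel] at hle
    exact ctx.neg_notMem_closure_pos hν hle

/-- A proper inclusion of abelian ideals can be refined by adjoining one root. -/
theorem IsAbelianIdeal.exists_insert {ctx : RootSystemCtx V} {I J : Set V}
    (hI : ctx.IsAbelianIdeal I) (hJ : ctx.IsAbelianIdeal J) (hIJ : I ⊂ J) :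
    ∃ γ ∈ J \ I, ctx.IsAbelianIdeal (insert γ I) := by
  have hfin : (J \ I).Finite :=
    ctx.Δ_finite.subset (Set.sdiff_subset.trans (hJ.1.trans ctx.pos_subset))
  obtain ⟨γ, hγ, hmax⟩ := ctx.exists_forall_add_notMem hfin (Set.nonempty_of_ssubset hIJ)
  have hsub : insert γ I ⊆ J := Set.insert_subset hγ.1 hIJ.1
  refine ⟨γ, hγ, hsub.trans hJ.1, fun μ hμ ν hν => hJ.2.1 μ (hsub hμ) ν (hsub hν), ?_⟩
  rintro μ (rfl | hμ) ν hν hadd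
  · refine Or.inr (by_contra fun hnot => hmax ν hν ⟨hJ.2.2 μ hγ.1 ν hν hadd, hnot⟩)
  · exact Or.inr (hI.2.2 μ hμ ν hν hadd)

end RootSystemCtx

/-- Proposition `ranked`: if `I ⊆ J` are abelian ideals of `Δ⁺`,
there is a chain of abelian ideals from `I` to `J` whose cardinalities increase
by one at each step; hence the poset of abelian ideals is ranked by cardinality. -/
theorem statement_0 {V : Type*} [AddCommGroup V] [Module ℚ V] (ctx : RootSystemCtx V)
    (I J : Set V) (hI : ctx.IsAbelianIdeal I) (hJ : ctx.IsAbelianIdeal J) (hIJ : I ⊆ J) :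
    ∃ (m : ℕ) (c : ℕ → Set V), c 0 = I ∧ c m = J ∧
      (∀ k ≤ m, ctx.IsAbelianIdeal (c k)) ∧
      (∀ k < m, c k ⊆ c (k + 1) ∧ (c (k + 1)).ncard = (c k).ncard + 1) := by
  have hJfin : J.Finite := ctx.Δ_finite.subset (hJ.1.trans ctx.pos_subset)
  induction hn : (J \ I).ncard generalizing I with
  | zero =>
    have hJI : J ⊆ I := Set.sdiff_eq_empty.mp ((Set.ncard_eq_zero hJfin.sdiff).mp hn)
    exact ⟨0, fun _ => I, rfl, hIJ.antisymm hJI, fun _ _ => hI, fun k hk => absurd hk k.not_lt_zero⟩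
  | succ n ih =>
    have hssub : I ⊂ J := ⟨hIJ, fun h => by simp [Set.sdiff_eq_empty.mpr h] at hn⟩
    obtain ⟨γ, hγ, hγI⟩ := hI.exists_insert hJ hssub
    have hcard : (J \ insert γ I).ncard = n := by
      have hdiff : J \ insert γ I = (J \ I) \ {γ} := by
        ext x
        simp only [Set.mem_sdiff, Set.mem_insert_iff, Set.mem_singleton_iff]
        tauto
      rw [hdiff, Set.ncard_sdiff_singleton_of_mem hγ, hn, Nat.add_sub_cancel]
    obtain ⟨m, c, hc0, hcm, hcI, hcs⟩ :=
      ih (insert γ I) hγI (Set.insert_subset hγ.1 hIJ) hcard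
    refine ⟨m + 1, fun k => k.casesOn I c, rfl, hcm, ?_, ?_⟩
    · rintro (_ | k) hk
      · exact hI
      · exact hcI k (Nat.le_of_succ_le_succ hk)
    · rintro (_ | k) hk
      · simp only [hc0]
        exact ⟨Set.subset_insert γ I, Set.ncard_insert_of_notMem hγ.2 (hJfin.subset hIJ)⟩
      · exact hcs k (Nat.lt_of_succ_lt_succ hk)
end

section
/- If w ∈ Ŵ is minuscule and I_w ≠ ∅ (i.e., w is not the identity), then w(α₀) + δ is a long positive root of Δ, i.e., w(α₀) + δ ∈ Δ⁺_l. -/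
open scoped BigOperators

namespace RootSystemCtx

variable {V : Type*} [AddCommGroup V] [Module ℚ V] (ctx : RootSystemCtx V)

/-- the coroot lattice, generated by the coroots `α∨`, `α ∈ Δ` -/
noncomputable def corootLattice : AddSubgroup V := AddSubgroup.closure (ctx.coroot '' ctx.Δ)

lemma B_self_pos {α : V} (hα : α ∈ ctx.Δ) : 0 < ctx.B α α :=
  ctx.B_posdef α fun h => ctx.zero_notMem_Δ (h ▸ hα)

lemma B_coroot_left (α γ : V) : ctx.B (ctx.coroot α) γ = 2 * ctx.B γ α / ctx.B α α := by
  simp only [coroot, map_smul, LinearMap.smul_apply, smul_eq_mul, ctx.B_symm α γ]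
  ring

lemma coroot_neg (α : V) : ctx.coroot (-α) = -ctx.coroot α := by
  simp [coroot]

lemma coroot_mem_corootLattice {α : V} (hα : α ∈ ctx.Δ) : ctx.coroot α ∈ ctx.corootLattice :=
  AddSubgroup.subset_closure ⟨α, hα, rfl⟩

lemma exists_int_of_mem_corootLattice {x : V} (hx : x ∈ ctx.corootLattice) {γ : V}
    (hγ : γ ∈ ctx.Δ) : ∃ n : ℤ, ctx.B x γ = n := by
  induction hx using AddSubgroup.closure_induction with
  | mem x hx =>
    obtain ⟨α, hα, rfl⟩ := hx
    rw [ctx.B_coroot_left]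
    exact ctx.crystallographic γ hγ α hα
  | zero => exact ⟨0, by simp⟩
  | add x y _ _ hx hy =>
    obtain ⟨m, hm⟩ := hx
    obtain ⟨n, hn⟩ := hy
    exact ⟨m + n, by simp [hm, hn]⟩
  | neg x _ hx =>
    obtain ⟨m, hm⟩ := hx
    exact ⟨-m, by simp [hm]⟩

/-- the reflection `s_α` of `V` -/
noncomputable def reflV (α : V) : V →ₗ[ℚ] V := LinearMap.id - (ctx.B (ctx.coroot α)).smulRight α

lemma reflV_apply (α γ : V) :
    ctx.reflV α γ = γ - (2 * ctx.B γ α / ctx.B α α) • α := by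
  simp [reflV, B_coroot_left]

lemma B_reflV_reflV {α : V} (hα : α ∈ ctx.Δ) (x y : V) :
    ctx.B (ctx.reflV α x) (ctx.reflV α y) = ctx.B x y := by
  have h := (ctx.B_self_pos hα).ne'
  simp only [reflV_apply, map_sub, map_smul, LinearMap.sub_apply, LinearMap.smul_apply,
    smul_eq_mul, ctx.B_symm α y]
  field_simp
  ring

lemma B_reflV_left {α : V} (hα : α ∈ ctx.Δ) (x y : V) :
    ctx.B (ctx.reflV α x) y = ctx.B x (ctx.reflV α y) := by
  have h := (ctx.B_self_pos hα).ne'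
  simp only [reflV_apply, map_sub, map_smul, LinearMap.sub_apply, LinearMap.smul_apply,
    smul_eq_mul, ctx.B_symm α y]
  field_simp

lemma reflV_mem {α γ : V} (hα : α ∈ ctx.Δ) (hγ : γ ∈ ctx.Δ) : ctx.reflV α γ ∈ ctx.Δ := by
  rw [reflV_apply]
  exact ctx.reflect_mem α hα γ hγ

lemma reflV_mem_corootLattice {α x : V} (hα : α ∈ ctx.Δ) (hx : x ∈ ctx.corootLattice) :
    ctx.reflV α x ∈ ctx.corootLattice := by
  induction hx using AddSubgroup.closure_induction with
  | mem x hx =>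
    obtain ⟨β, hβ, rfl⟩ := hx
    refine AddSubgroup.subset_closure ⟨ctx.reflV α β, ctx.reflV_mem hα hβ, ?_⟩
    rw [coroot, coroot, ctx.B_reflV_reflV hα, map_smul]
  | zero => simp
  | add x y _ _ hx hy => rw [map_add]; exact add_mem hx hy
  | neg x _ hx => rw [map_neg]; exact neg_mem hx

lemma refl_apply {α : V} (hα : α ∈ ctx.Δ) (k t : ℚ) (γ : V) :
    ctx.refl (α, k, 0) (γ, t, 0) =
      (ctx.reflV α γ, t + ctx.B (-(k • ctx.coroot α)) γ, 0) := by
  have h : ctx.Bhat (α, k, 0) (α, k, 0) ≠ 0 := by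
    simpa [Bhat] using (ctx.B_self_pos hα).ne'
  rw [refl, dif_neg h, Module.reflection_apply, reflV_apply]
  simp only [map_neg, map_smul, LinearMap.neg_apply, LinearMap.smul_apply, B_coroot_left]
  simp only [Bhat, LinearMap.mk₂_apply, smul_eq_mul, Prod.smul_mk, Prod.mk_sub_mk,
    Prod.mk.injEq, ctx.B_symm α γ]
  refine ⟨?_, ?_, ?_⟩
  · congr 2
    ring
  · ring
  · ring

lemma refl_inv (β : V × ℚ × ℚ) : (ctx.refl β)⁻¹ = ctx.refl β := by
  rw [refl]
  split_ifs with h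
  · rfl
  · exact Module.reflection_symm _

/-- An element of the affine Weyl group acts on `V ⊕ ℚδ` as an isometry of `V` preserving the
roots, followed by a translation by an element of the coroot lattice. -/
lemma exists_translation_of_mem_What {w : (V × ℚ × ℚ) ≃ₗ[ℚ] (V × ℚ × ℚ)}
    (hw : w ∈ ctx.What) :
    ∃ v : V →ₗ[ℚ] V, ∃ x ∈ ctx.corootLattice, (∀ γ ∈ ctx.Δ, v γ ∈ ctx.Δ) ∧
      (∀ γ, ctx.B (v γ) (v γ) = ctx.B γ γ) ∧
      ∀ γ t, w (γ, t, 0) = (v γ, t + ctx.B x γ, 0) := by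
  have step : ∀ (w : (V × ℚ × ℚ) ≃ₗ[ℚ] (V × ℚ × ℚ)), ∀ β ∈ ctx.Δhat,
      (∃ v : V →ₗ[ℚ] V, ∃ x ∈ ctx.corootLattice, (∀ γ ∈ ctx.Δ, v γ ∈ ctx.Δ) ∧
        (∀ γ, ctx.B (v γ) (v γ) = ctx.B γ γ) ∧
        ∀ γ t, w (γ, t, 0) = (v γ, t + ctx.B x γ, 0)) →
      ∃ v : V →ₗ[ℚ] V, ∃ x ∈ ctx.corootLattice, (∀ γ ∈ ctx.Δ, v γ ∈ ctx.Δ) ∧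
        (∀ γ, ctx.B (v γ) (v γ) = ctx.B γ γ) ∧
        ∀ γ t, (w * ctx.refl β) (γ, t, 0) = (v γ, t + ctx.B x γ, 0) := by
    rintro w _ ⟨α, hα, k, rfl⟩ ⟨v, x, hx, hv, hB, hvx⟩
    refine ⟨v ∘ₗ ctx.reflV α, -((k : ℚ) • ctx.coroot α) + ctx.reflV α x,
      add_mem (neg_mem ?_) (ctx.reflV_mem_corootLattice hα hx),
      fun γ hγ => hv _ (ctx.reflV_mem hα hγ), fun γ => ?_, fun γ t => ?_⟩
    · rw [Int.cast_smul_eq_zsmul]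
      exact zsmul_mem (ctx.coroot_mem_corootLattice hα) k
    · simp [hB, ctx.B_reflV_reflV hα]
    · rw [LinearEquiv.mul_apply, ctx.refl_apply hα, hvx, ← ctx.B_reflV_left hα, map_add,
        LinearMap.add_apply, add_assoc, LinearMap.comp_apply]
  rw [What] at hw
  induction hw using Subgroup.closure_induction_right with
  | one => exact ⟨LinearMap.id, 0, zero_mem _, by simp⟩
  | mul_right w _ s hs ih =>
    obtain ⟨β, hβ, rfl⟩ := hs
    exact step w β hβ ih
  | mul_inv_cancel w _ s hs ih =>
    obtain ⟨β, hβ, rfl⟩ := hs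
    rw [refl_inv]
    exact step w β hβ ih

lemma sum_coroot_eq_zero (s : Multiset V) (hs : ∀ β ∈ s, β ∈ ctx.Δ)
    (h : ∀ γ ∈ ctx.Δ, ctx.B (s.map ctx.coroot).sum γ ≤ 1) : (s.map ctx.coroot).sum = 0 := by
  classical
  induction hn : s.card generalizing s with
  | zero => simp [Multiset.card_eq_zero.mp hn]
  | succ n ih =>
    set x := (s.map ctx.coroot).sum with hx
    by_contra hx0
    have hmem : x ∈ ctx.corootLattice := by
      refine AddSubgroup.multiset_sum_mem _ _ fun y hy => ?_
      obtain ⟨β, hβ, rfl⟩ := Multiset.mem_map.mp hy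
      exact ctx.coroot_mem_corootLattice (hs β hβ)
    obtain ⟨β, hβ, hpos⟩ : ∃ β ∈ s, 0 < ctx.B x β := by
      by_contra! hcon
      refine (ctx.B_posdef x hx0).not_ge ?_
      conv_lhs => rw [hx, ctx.B_symm, ← hx, map_multiset_sum, Multiset.map_map]
      refine (Multiset.sum_map_le_sum_map _ (fun _ => 0) fun β hβ => ?_).trans (by simp)
      rw [Function.comp_apply, ctx.B_symm, B_coroot_left]
      exact div_nonpos_of_nonpos_of_nonneg (by linarith [hcon β hβ])
        (ctx.B_self_pos (hs β hβ)).le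
    have hβΔ := hs β hβ
    have hone : ctx.B x β = 1 := by
      obtain ⟨n, hn⟩ := ctx.exists_int_of_mem_corootLattice hmem hβΔ
      have hle := h β hβΔ
      rw [hn] at hpos hle ⊢
      norm_cast at hpos hle ⊢
      omega
    have hsplit : x = ctx.coroot β + ((s.erase β).map ctx.coroot).sum := by
      rw [hx, ← Multiset.sum_cons, ← Multiset.map_cons, Multiset.cons_erase hβ]
    have hzero : ((s.erase β).map ctx.coroot).sum = 0 := by
      refine ih _ (fun β' hβ' => hs β' (Multiset.mem_of_mem_erase hβ')) (fun γ hγ => ?_)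
        (by rw [Multiset.card_erase_of_mem hβ, hn]; rfl)
      have hle := h _ (ctx.reflV_mem hβΔ hγ)
      rw [reflV_apply, map_sub, map_smul, hone, smul_eq_mul, mul_one, ← B_coroot_left] at hle
      rw [eq_sub_iff_add_eq'.mpr hsplit.symm, map_sub, LinearMap.sub_apply]
      exact hle
    rw [hsplit, hzero, add_zero, B_coroot_left,
      mul_div_cancel_right₀ _ (ctx.B_self_pos hβΔ).ne'] at hone
    norm_num at hone

/-- The coroot lattice contains no nonzero minuscule coweight. -/
lemma eq_zero_of_mem_corootLattice {x : V} (hx : x ∈ ctx.corootLattice)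
    (h : ∀ γ ∈ ctx.Δ, ctx.B x γ ≤ 1) : x = 0 := by
  obtain ⟨s, hs, rfl⟩ : ∃ s : Multiset V, (∀ β ∈ s, β ∈ ctx.Δ) ∧
      (s.map ctx.coroot).sum = x := by
    clear h
    induction hx using AddSubgroup.closure_induction with
    | mem x hx =>
      obtain ⟨α, hα, rfl⟩ := hx
      exact ⟨{α}, by simpa using hα, by simp⟩
    | zero => exact ⟨0, by simp⟩
    | add x y _ _ hx hy =>
      obtain ⟨s, hs, rfl⟩ := hx
      obtain ⟨t, ht, rfl⟩ := hy
      exact ⟨s + t, fun β hβ => (Multiset.mem_add.mp hβ).elim (hs β) (ht β), by simp⟩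
    | neg x _ hx =>
      obtain ⟨s, hs, rfl⟩ := hx
      refine ⟨s.map fun β => -β, fun β hβ => ?_, ?_⟩
      · obtain ⟨α, hα, rfl⟩ := Multiset.mem_map.mp hβ
        exact ctx.neg_mem_Δ α (hs α hα)
      · simp [Multiset.map_map, coroot_neg]
  exact ctx.sum_coroot_eq_zero s hs h

lemma snd_nonneg_of_mem_PosHat {v : V} {t r : ℚ} (h : (v, t, r) ∈ ctx.PosHat) : 0 ≤ t := by
  rcases h with ⟨α, _, h⟩ | ⟨α, _, k, hk, h⟩
  · simp only [Prod.mk.injEq] at h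
    exact h.2.1.ge
  · simp only [Prod.mk.injEq] at h
    rw [h.2.1]
    exact_mod_cast zero_le_one.trans hk

lemma mem_Pos_of_mem_PosHat {v : V} (h : (v, (0 : ℚ), (0 : ℚ)) ∈ ctx.PosHat) : v ∈ ctx.Pos := by
  rcases h with ⟨α, hα, h⟩ | ⟨α, _, k, hk, h⟩
  · simp only [Prod.mk.injEq] at h
    exact h.1 ▸ hα
  · simp only [Prod.mk.injEq] at h
    have : k = 0 := by exact_mod_cast h.2.1.symm
    omega

lemma mem_PosHat_or_neg_mem {β : V} (hβ : β ∈ ctx.Δ) (k : ℤ) :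
    (β, (k : ℚ), (0 : ℚ)) ∈ ctx.PosHat ∨ -(β, (k : ℚ), (0 : ℚ)) ∈ ctx.PosHat := by
  rcases lt_trichotomy k 0 with hk | rfl | hk
  · exact Or.inr (Or.inr ⟨-β, ctx.neg_mem_Δ β hβ, -k, by omega, by simp⟩)
  · rcases ctx.mem_pos_or_neg_pos β hβ with h | h
    · exact Or.inl (Or.inl ⟨β, h, by simp⟩)
    · exact Or.inr (Or.inl ⟨-β, h, by simp⟩)
  · exact Or.inl (Or.inr ⟨β, hβ, k, by omega, rfl⟩)

end RootSystemCtx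

/-- Proposition `floor-1`: if `w` is a nontrivial minuscule
element, then `w(α₀) + δ` is a long positive root of `Δ`. -/
theorem statement_3 {V : Type*} [AddCommGroup V] [Module ℚ V] (ctx : RootSystemCtx V)
    (w : (V × ℚ × ℚ) ≃ₗ[ℚ] (V × ℚ × ℚ)) (hw : ctx.IsMinuscule w)
    (hne : (ctx.idealOf w).Nonempty) :
    ∃ μ ∈ ctx.PosLong, w ctx.alpha0 + ctx.δhat = ctx.emb μ := by
  obtain ⟨v, x, hx, hv, hB, hvx⟩ := ctx.exists_translation_of_mem_What hw.1
  have hpos : ∀ γ ∈ ctx.Δ, ∀ k : ℤ, k ≠ 1 → (γ, (k : ℚ), (0 : ℚ)) ∈ ctx.PosHat →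
      (v γ, k + ctx.B x γ, (0 : ℚ)) ∈ ctx.PosHat := by
    intro γ hγ k hk hmem
    obtain ⟨n, hn⟩ := ctx.exists_int_of_mem_corootLattice hx hγ
    have hor := ctx.mem_PosHat_or_neg_mem (hv γ hγ) (k + n)
    rw [Int.cast_add, ← hn] at hor
    refine hor.resolve_right fun hneg => ?_
    obtain ⟨γ', _, h⟩ := hw.2 (γ, (k : ℚ), (0 : ℚ)) ⟨hmem, by rwa [hvx]⟩
    simp only [RootSystemCtx.δhat, RootSystemCtx.emb, Prod.mk_sub_mk, Prod.mk.injEq,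
      sub_zero] at h
    exact hk (by exact_mod_cast h.2.1)
  have hnonneg : ∀ y ∈ AddSubmonoid.closure ctx.Pos, 0 ≤ ctx.B x y := by
    intro y hy
    induction hy using AddSubmonoid.closure_induction with
    | mem γ hγ =>
      have := hpos γ (ctx.pos_subset hγ) 0 (by norm_num) (Or.inl ⟨γ, hγ, by simp⟩)
      simpa using ctx.snd_nonneg_of_mem_PosHat this
    | zero => simp
    | add y z _ _ hy hz => rw [map_add]; exact add_nonneg hy hz
  have hθ : ∀ ν ∈ ctx.Δ, ctx.B x ν ≤ ctx.B x ctx.θ := fun ν hν => by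
    simpa using hnonneg _ (ctx.θ_highest ν hν)
  have hθΔ := ctx.pos_subset ctx.θ_pos
  have hle : ctx.B x ctx.θ ≤ 2 := by
    have := hpos (-ctx.θ) (ctx.neg_mem_Δ _ hθΔ) 2 (by norm_num)
      (Or.inr ⟨_, ctx.neg_mem_Δ _ hθΔ, 2, by norm_num, rfl⟩)
    have := ctx.snd_nonneg_of_mem_PosHat this
    rw [map_neg] at this
    push_cast at this
    linarith
  have hge : 1 ≤ ctx.B x ctx.θ := by
    obtain ⟨γ, hγ, _, hγw⟩ := hne
    have hdiff : ctx.δhat - ctx.emb γ = (-γ, (1 : ℚ), (0 : ℚ)) := by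
      simp [RootSystemCtx.δhat, RootSystemCtx.emb]
    rw [hdiff, hvx] at hγw
    have := ctx.snd_nonneg_of_mem_PosHat hγw
    simp only [map_neg] at this
    linarith [hθ γ (ctx.pos_subset hγ)]
  have hne1 : ctx.B x ctx.θ ≠ 1 := fun h => by
    have hx0 := ctx.eq_zero_of_mem_corootLattice hx fun γ hγ => h ▸ hθ γ hγ
    simp [hx0] at h
  have heq : ctx.B x ctx.θ = 2 := by
    obtain ⟨n, hn⟩ := ctx.exists_int_of_mem_corootLattice hx hθΔ
    rw [hn] at hle hge hne1 ⊢
    norm_cast at hle hge hne1 ⊢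
    omega
  refine ⟨v (-ctx.θ), ⟨ctx.mem_Pos_of_mem_PosHat ?_, by simp [hB]⟩, ?_⟩
  · have := hpos (-ctx.θ) (ctx.neg_mem_Δ _ hθΔ) 2 (by norm_num)
      (Or.inr ⟨_, ctx.neg_mem_Δ _ hθΔ, 2, by norm_num, rfl⟩)
    simpa [heq] using this
  · rw [RootSystemCtx.alpha0, hvx, map_neg (ctx.B x), heq]
    simp only [RootSystemCtx.δhat, RootSystemCtx.emb, Prod.mk_add_mk, add_zero, Prod.mk.injEq,
      true_and, and_true]
    norm_num
end
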